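/- Let $T^2$ be a bi-tree with tensor-product weight $w = w_1 \otimes w_2 \geq 0$. For positive measures $\mu, \rho$ on $T^2$ and $\delta > 0$, define the truncated potential $\mathbb{V}^\mu_\delta := \mathbb{I}\big( \mathbf{1}_{\{\mathbb{V}^\mu \leq \delta\}}\, w\, \mathbb{I}^*\mu \big)$, where $\mathbb{V}^\mu = \mathbb{I}(w \mathbb{I}^*\mu)$, and the truncated energy $\mathcal{E}_\delta[\mu] := \sum_{\{\mathbb{V}^\mu \leq \delta\}} w (\mathbb{I}^*\mu)^2$, energy $\mathcal{E}[\rho] := \sum_{T^2} w (\mathbb{I}^*\rho)^2$, and mass $|\rho| := \sum_{T^2} \rho$. Then $\Big( \sum_{T^2} \mathbb{V}^\mu_\delta \, \rho \Big)^4 \leq 28\, \delta^2\, \mathcal{E}_\delta[\mu]\, \mathcal{E}[\rho]\, |\rho|^2$. -/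

import Mathlib

open Finset
open scoped Classical

/-- A tree order: the set of elements above any given element is totally ordered. -/
def IsTreeOrder (T : Type*) [PartialOrder T] : Prop :=
  ∀ ω a b : T, ω ≤ a → ω ≤ b → a ≤ b ∨ b ≤ a

/-- The Hardy operator `I f α = ∑_{α' ≥ α} f α'`. -/
noncomputable def hI {T : Type*} [Fintype T] [PartialOrder T] (f : T → ℝ) (a : T) : ℝ :=
  ∑ b, if a ≤ b then f b else 0

/-- The adjoint Hardy operator `I* f β = ∑_{α ≤ β} f α`. -/
noncomputable def hIstar {T : Type*} [Fintype T] [PartialOrder T] (f : T → ℝ) (b : T) : ℝ :=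
  ∑ a, if a ≤ b then f a else 0

/-- `b` is a child of `β`: a maximal element of the set of elements strictly below `β`. -/
def IsChild {T : Type*} [PartialOrder T] (b β : T) : Prop :=
  b < β ∧ ∀ c, b < c → c < β → False

/-- The difference operator `Δ f β = f β - ∑_{β' ∈ ch β} f β'`. -/
noncomputable def hDelta {T : Type*} [Fintype T] [PartialOrder T] (f : T → ℝ) (β : T) : ℝ :=
  f β - ∑ b, if IsChild b β then f b else 0

/-- A superadditive function on a tree: `f β ≥ ∑_{β' ∈ ch β} f β'` for all `β`. -/
def Superadd {T : Type*} [Fintype T] [PartialOrder T] (f : T → ℝ) : Prop :=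
  ∀ β : T, (∑ b, if IsChild b β then f b else 0) ≤ f β

/-- The Hardy operator acting in the first coordinate of a bi-tree. -/
noncomputable def hI1 {T1 T2 : Type*} [Fintype T1] [PartialOrder T1]
    (f : T1 × T2 → ℝ) (a : T1 × T2) : ℝ :=
  ∑ b : T1, if a.1 ≤ b then f (b, a.2) else 0

/-- The Hardy operator acting in the second coordinate of a bi-tree. -/
noncomputable def hI2 {T1 T2 : Type*} [Fintype T2] [PartialOrder T2]
    (f : T1 × T2 → ℝ) (a : T1 × T2) : ℝ :=
  ∑ b : T2, if a.2 ≤ b then f (a.1, b) else 0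

/-- Superadditivity in the first parameter separately. -/
def Superadd1 {T1 T2 : Type*} [Fintype T1] [PartialOrder T1]
    (f : T1 × T2 → ℝ) : Prop :=
  ∀ (β : T1) (a2 : T2), (∑ b, if IsChild b β then f (b, a2) else 0) ≤ f (β, a2)

/-- Superadditivity in the second parameter separately. -/
def Superadd2 {T1 T2 : Type*} [Fintype T2] [PartialOrder T2]
    (f : T1 × T2 → ℝ) : Prop :=
  ∀ (a1 : T1) (β : T2), (∑ b, if IsChild b β then f (a1, b) else 0) ≤ f (a1, β)

section Hardy

variable {T : Type*} [Fintype T] [PartialOrder T]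

lemma hI_nonneg {f : T → ℝ} (hf : ∀ x, 0 ≤ f x) (a : T) : 0 ≤ hI f a :=
  sum_nonneg fun b _ => by split_ifs <;> simp [hf]

lemma hIstar_nonneg {f : T → ℝ} (hf : ∀ x, 0 ≤ f x) (a : T) : 0 ≤ hIstar f a :=
  sum_nonneg fun b _ => by split_ifs <;> simp [hf]

lemma hI_mono {f g : T → ℝ} (h : ∀ x, f x ≤ g x) (a : T) : hI f a ≤ hI g a :=
  sum_le_sum fun b _ => by split_ifs <;> simp [h]

lemma hI_const_mul (c : ℝ) (f : T → ℝ) (a : T) : hI (fun x => c * f x) a = c * hI f a := by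
  simp [hI, mul_sum]

lemma hIstar_const_mul (c : ℝ) (f : T → ℝ) (a : T) :
    hIstar (fun x => c * f x) a = c * hIstar f a := by
  simp [hIstar, mul_sum]

lemma hI_antitone {f : T → ℝ} (hf : ∀ x, 0 ≤ f x) : Antitone (hI f) := by
  intro a b hab
  refine sum_le_sum fun c _ => ?_
  by_cases hbc : b ≤ c
  · simp [hbc, hab.trans hbc]
  · simp only [hbc, if_false]
    split_ifs <;> simp [hf]

/-- `hI` and `hIstar` are adjoint to each other. -/
lemma sum_hI_mul (f g : T → ℝ) : ∑ a, hI f a * g a = ∑ a, f a * hIstar g a := by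
  simp only [hI, hIstar, sum_mul, mul_sum]
  rw [sum_comm]
  refine sum_congr rfl fun a _ => sum_congr rfl fun b _ => ?_
  split_ifs <;> simp

/-- On a tree, the product of two potentials is controlled by summing over comparable pairs. -/
lemma hI_mul_hI_le (hT : IsTreeOrder T) {u v : T → ℝ} (hu : ∀ x, 0 ≤ u x) (hv : ∀ x, 0 ≤ v x)
    (a : T) : hI u a * hI v a ≤ hI (fun x => u x * hI v x + v x * hI u x) a := by
  have key : hI (fun x => u x * hI v x + v x * hI u x) a
      = ∑ x, ∑ y, ((if a ≤ x then if x ≤ y then u x * v y else 0 else 0)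
          + if a ≤ y then if y ≤ x then u x * v y else 0 else 0) := by
    simp only [sum_add_distrib]
    conv_rhs => rw [sum_comm (f := fun x y => if a ≤ y then if y ≤ x then u x * v y else 0 else 0)]
    rw [← sum_add_distrib]
    refine sum_congr rfl fun x _ => ?_
    split_ifs
    · simp [hI, mul_sum, mul_comm]
    · simp
  rw [key, hI, hI, sum_mul_sum]
  refine sum_le_sum fun x _ => sum_le_sum fun y _ => ?_
  have huv := mul_nonneg (hu x) (hv y)
  by_cases hx : a ≤ x
  · by_cases hy : a ≤ y
    · rcases hT a x y hx hy with h | h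
      · simp only [hx, hy, h, if_true]
        split_ifs <;> linarith
      · simp only [hx, hy, h, if_true]
        split_ifs <;> linarith
    · simp only [hx, hy, if_true, if_false, mul_zero]
      split_ifs <;> linarith
  · simp only [hx, if_false, zero_mul, zero_add]
    split_ifs <;> linarith

lemma hI_sq_le (hT : IsTreeOrder T) {u : T → ℝ} (hu : ∀ x, 0 ≤ u x) (a : T) :
    hI u a ^ 2 ≤ 2 * hI (fun x => u x * hI u x) a := by
  have h := hI_mul_hI_le hT hu hu a
  simp only [← two_mul, hI_const_mul] at h
  rwa [sq]

/-- A weighted sum of `hIstar ν`, truncated to an upper set on which the potential of the weight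
is at most `δ`, is at most `δ` times its value at the top. -/
lemma hIstar_truncated_mul_le (hT : IsTreeOrder T) {g ν : T → ℝ} (hg : ∀ x, 0 ≤ g x)
    (hν : ∀ x, 0 ≤ ν x) {P : T → Prop} (hP : ∀ a b, a ≤ b → P a → P b) {δ : ℝ} (hδ : 0 ≤ δ)
    (hgδ : ∀ m, P m → hI g m ≤ δ) (b : T) :
    hIstar (fun a => g a * ((if P a then 1 else 0) * hIstar ν a)) b
      ≤ δ * ((if P b then 1 else 0) * hIstar ν b) := by
  by_cases hb : P b
  · have chain : ∀ x, (∑ a, if x ≤ a then if P a then g a else 0 else 0) ≤ δ := by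
      intro x
      rcases (univ.filter fun a => x ≤ a ∧ P a).eq_empty_or_nonempty with h | h
      · rw [sum_eq_zero]
        · exact hδ
        · intro a _
          have : ¬ (x ≤ a ∧ P a) := fun ha => by
            simpa [h] using (mem_filter.2 ⟨mem_univ a, ha⟩ : a ∈ univ.filter fun a => x ≤ a ∧ P a)
          grind
      · obtain ⟨m, hm⟩ := exists_minimal h
        have hmP := (mem_filter.1 hm.prop).2
        refine le_trans (sum_le_sum fun a _ => ?_) (hgδ m hmP.2)
        by_cases hxa : x ≤ a
        · by_cases hPa : P a
          · have : m ≤ a := by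
              rcases hT x m a hmP.1 hxa with h' | h'
              · exact h'
              · exact hm.le_of_le (mem_filter.2 ⟨mem_univ a, hxa, hPa⟩) h'
            simp [hxa, hPa, this]
          · simp only [hPa, if_false, ite_self]
            split_ifs <;> simp [hg]
        · simp only [hxa, if_false]
          split_ifs <;> simp [hg]
    have swap : hIstar (fun a => g a * ((if P a then 1 else 0) * hIstar ν a)) b
        = ∑ x, ν x * ∑ a, if x ≤ a ∧ a ≤ b then if P a then g a else 0 else 0 := by
      simp only [hIstar, mul_sum]
      rw [sum_comm]
      refine sum_congr rfl fun a _ => ?_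
      by_cases hab : a ≤ b
      · simp only [hab, if_true, and_true]
        refine sum_congr rfl fun x _ => ?_
        split_ifs <;> simp [mul_comm]
      · simp [hab]
    rw [swap, if_pos hb, one_mul, hIstar, mul_sum]
    refine sum_le_sum fun x _ => ?_
    by_cases hxb : x ≤ b
    · rw [if_pos hxb, mul_comm δ]
      refine mul_le_mul_of_nonneg_left (le_trans (sum_le_sum fun a _ => ?_) (chain x)) (hν x)
      have := hg a
      split_ifs <;> tauto
    · rw [if_neg hxb, sum_eq_zero]
      · simp
      · intro a _
        rw [if_neg fun h => hxb (h.1.trans h.2)]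
  · have : ∀ a, a ≤ b → ¬ P a := fun a hab ha => hb (hP a b hab ha)
    rw [if_neg hb, zero_mul, mul_zero, hIstar]
    refine (sum_eq_zero fun a _ => ?_).le
    split_ifs with h1 h2
    · exact absurd h2 (this a h1)
    · simp
    · rfl

end Hardy

section BiTree

variable {T1 T2 : Type*} [Fintype T1] [PartialOrder T1] [Fintype T2] [PartialOrder T2]

lemma hI_prod (F : T1 × T2 → ℝ) (a : T1) (b : T2) :
    hI F (a, b) = hI (fun x => hI (fun y => F (x, y)) b) a := by
  simp only [hI, Fintype.sum_prod_type, Prod.mk_le_mk]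
  refine sum_congr rfl fun x _ => ?_
  split_ifs with h <;> simp [h]

lemma hI_comm (F : T1 → T2 → ℝ) (a : T1) (b : T2) :
    hI (fun x => hI (F x) b) a = hI (fun y => hI (fun x => F x y) a) b := by
  simp only [hI, ← sum_filter]
  exact sum_comm

lemma hIstar_prod (F : T1 × T2 → ℝ) (a : T1) (b : T2) :
    hIstar F (a, b) = hIstar (fun x => hIstar (fun y => F (x, y)) b) a := by
  simp only [hIstar, Fintype.sum_prod_type, Prod.mk_le_mk]
  refine sum_congr rfl fun x _ => ?_
  split_ifs with h <;> simp [h]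

lemma hIstar_prod' (F : T1 × T2 → ℝ) (a : T1) (b : T2) :
    hIstar F (a, b) = hIstar (fun y => hIstar (fun x => F (x, y)) a) b := by
  simp only [hIstar, Fintype.sum_prod_type_right, Prod.mk_le_mk]
  refine sum_congr rfl fun x _ => ?_
  split_ifs with h <;> simp [h]

lemma sum_hI_mul_hI (A B : T1 → T2 → ℝ) :
    ∑ a, ∑ b, hI (fun x => A x b) a * hI (fun y => B a y) b
      = ∑ x, ∑ y, hIstar (fun b => A x b) y * hIstar (fun a => B a y) x := by
  have e : ∀ b : T2, ∑ a, hI (fun x => A x b) a * hI (fun y => B a y) b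
      = ∑ x, A x b * hI (fun y => hIstar (fun a => B a y) x) b := by
    intro b
    rw [sum_hI_mul]
    refine sum_congr rfl fun x _ => ?_
    congr 1
    simp only [hI, hIstar, ← sum_filter]
    exact sum_comm
  rw [sum_comm, sum_congr rfl fun b _ => e b, sum_comm]
  refine sum_congr rfl fun x _ => ?_
  simp only [mul_comm (A x _), mul_comm (hIstar (A x) _)]
  exact sum_hI_mul _ _

variable {w1 : T1 → ℝ} {w2 : T2 → ℝ} {f : T1 → T2 → ℝ} {δ : ℝ}

/-- The square of a weighted potential on a bi-tree is dominated by the potential of the sum of a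
diagonal and a mixed term. -/
lemma hI_prod_sq_le (h1 : IsTreeOrder T1) (h2 : IsTreeOrder T2)
    (hw1 : ∀ x, 0 ≤ w1 x) (hw2 : ∀ x, 0 ≤ w2 x) (hf : ∀ a b, 0 ≤ f a b) (a : T1) (b : T2) :
    hI (fun z : T1 × T2 => w1 z.1 * w2 z.2 * f z.1 z.2) (a, b) ^ 2
      ≤ 2 * hI (fun z : T1 × T2 => w1 z.1 * w2 z.2 *
          (f z.1 z.2 * hI (fun x => w1 x * hI (fun y => w2 y * f x y) z.2) z.1
            + hI (fun x => w1 x * f x z.2) z.1 * hI (fun y => w2 y * f z.1 y) z.2)) (a, b) := by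
  have hF : ∀ x y, 0 ≤ w1 x * w2 y * f x y := fun x y =>
    mul_nonneg (mul_nonneg (hw1 x) (hw2 y)) (hf x y)
  rw [hI_prod, hI_prod]
  refine (hI_sq_le h1 (fun x => hI_nonneg (hF x) b) a).trans ?_
  refine mul_le_mul_of_nonneg_left (hI_mono (fun x => ?_) a) zero_le_two
  rw [hI_comm (fun x y => w1 x * w2 y * f x y)]
  refine (hI_mul_hI_le h2 (hF x) (fun y => hI_nonneg (fun x => hF x y) x) b).trans
    (le_of_eq ?_)
  congr 1
  funext y
  rw [← hI_comm (fun x y => w1 x * w2 y * f x y)]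
  have e1 : ∀ x', hI (fun y => w1 x' * w2 y * f x' y) y = w1 x' * hI (fun y => w2 y * f x' y) y :=
    fun x' => by simp only [mul_assoc, hI_const_mul]
  have e2 : hI (fun x => w1 x * w2 y * f x y) x = w2 y * hI (fun x => w1 x * f x y) x := by
    rw [← hI_const_mul]
    congr 1
    funext x
    ring
  simp only [e1, e2]
  ring

lemma energy_le (h1 : IsTreeOrder T1) (h2 : IsTreeOrder T2)
    (hw1 : ∀ x, 0 ≤ w1 x) (hw2 : ∀ x, 0 ≤ w2 x) (hf : ∀ a b, 0 ≤ f a b) (hδ : 0 ≤ δ)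
    (hJ : ∀ a b, f a b * hI (fun x => w1 x * hI (fun y => w2 y * f x y) b) a ≤ δ * f a b)
    (hJ1 : ∀ a b, hIstar (fun x => w1 x * hI (fun y => w2 y * f x y) b * f x b) a ≤ δ * f a b)
    (hJ2 : ∀ a b, hIstar (fun y => w2 y * hI (fun x => w1 x * f x y) a * f a y) b ≤ δ * f a b) :
    ∑ a, ∑ b, w1 a * w2 b *
        (f a b * hI (fun x => w1 x * hI (fun y => w2 y * f x y) b) a
          + hI (fun x => w1 x * f x b) a * hI (fun y => w2 y * f a y) b) ^ 2
      ≤ 7 * δ ^ 2 * ∑ a, ∑ b, w1 a * w2 b * f a b ^ 2 := by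
  have hw : ∀ a b, 0 ≤ w1 a * w2 b := fun a b => mul_nonneg (hw1 a) (hw2 b)
  set p : T1 → T2 → ℝ := fun a b => hI (fun x => w1 x * f x b) a with hp
  set q : T1 → T2 → ℝ := fun a b => hI (fun y => w2 y * f a y) b with hq
  set J : T1 → T2 → ℝ := fun a b => hI (fun x => w1 x * q x b) a with hJdef
  have p0 : ∀ a b, 0 ≤ p a b := fun a b => hI_nonneg (fun x => mul_nonneg (hw1 x) (hf x b)) a
  have q0 : ∀ a b, 0 ≤ q a b := fun a b => hI_nonneg (fun y => mul_nonneg (hw2 y) (hf a y)) b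
  have J0 : ∀ a b, 0 ≤ J a b := fun a b => hI_nonneg (fun x => mul_nonneg (hw1 x) (q0 x b)) a
  have mixed : ∑ a, ∑ b, w1 a * w2 b * (f a b * p a b * q a b)
      ≤ δ * ∑ a, ∑ b, w1 a * w2 b * f a b ^ 2 := by
    rw [sum_comm]
    have e : ∀ b, ∑ a, w1 a * w2 b * (f a b * p a b * q a b)
        = ∑ a, w1 a * f a b * (w2 b * hIstar (fun x => w1 x * q x b * f x b) a) := by
      intro b
      have h := sum_hI_mul (fun x => w1 x * f x b) fun x => w2 b * (w1 x * q x b * f x b)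
      simp only [hIstar_const_mul] at h
      rw [← h]
      refine sum_congr rfl fun a _ => ?_
      simp only [hp]
      ring
    rw [sum_congr rfl fun b _ => e b, sum_comm, mul_sum]
    simp only [mul_sum]
    refine sum_le_sum fun a _ => sum_le_sum fun b _ => ?_
    have := mul_le_mul_of_nonneg_left (hJ1 a b) (mul_nonneg (hw a b) (hf a b))
    simp only [hq]
    linarith
  have square : ∑ a, ∑ b, w1 a * w2 b * (p a b * q a b) ^ 2
      ≤ 4 * δ ^ 2 * ∑ a, ∑ b, w1 a * w2 b * f a b ^ 2 := by
    have hpsq : ∀ a b, p a b ^ 2 ≤ 2 * hI (fun x => w1 x * f x b * p x b) a := fun a b =>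
      hI_sq_le h1 (fun x => mul_nonneg (hw1 x) (hf x b)) a
    have hqsq : ∀ a b, q a b ^ 2 ≤ 2 * hI (fun y => w2 y * f a y * q a y) b := fun a b =>
      hI_sq_le h2 (fun y => mul_nonneg (hw2 y) (hf a y)) b
    calc ∑ a, ∑ b, w1 a * w2 b * (p a b * q a b) ^ 2
        ≤ ∑ a, ∑ b, 4 * (hI (fun x => w2 b * (w1 x * f x b * p x b)) a
            * hI (fun y => w1 a * (w2 y * f a y * q a y)) b) := by
          refine sum_le_sum fun a _ => sum_le_sum fun b _ => ?_
          rw [hI_const_mul, hI_const_mul, mul_pow]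
          have := mul_le_mul_of_nonneg_left (mul_le_mul (hpsq a b) (hqsq a b) (sq_nonneg _)
            ((sq_nonneg _).trans (hpsq a b))) (hw a b)
          linarith
      _ = 4 * ∑ a, ∑ b, hIstar (fun y => w2 y * (w1 a * f a y * p a y)) b
            * hIstar (fun x => w1 x * (w2 b * f x b * q x b)) a := by
          simp only [← mul_sum]
          rw [sum_hI_mul_hI (fun x b => w2 b * (w1 x * f x b * p x b))
            (fun a y => w1 a * (w2 y * f a y * q a y))]
      _ ≤ 4 * ∑ a, ∑ b, δ ^ 2 * (w1 a * w2 b * f a b ^ 2) := by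
          refine mul_le_mul_of_nonneg_left
            (sum_le_sum fun a _ => sum_le_sum fun b _ => ?_) (by norm_num)
          have e1 : hIstar (fun y => w2 y * (w1 a * f a y * p a y)) b
              = w1 a * hIstar (fun y => w2 y * p a y * f a y) b := by
            rw [← hIstar_const_mul]
            congr 1
            funext y
            ring
          have e2 : hIstar (fun x => w1 x * (w2 b * f x b * q x b)) a
              = w2 b * hIstar (fun x => w1 x * q x b * f x b) a := by
            rw [← hIstar_const_mul]
            congr 1
            funext x
            ring
          rw [e1, e2]
          have := mul_le_mul_of_nonneg_left (mul_le_mul (hJ2 a b) (hJ1 a b)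
            (hIstar_nonneg (fun x => mul_nonneg (mul_nonneg (hw1 x) (q0 x b)) (hf x b)) a)
            (mul_nonneg hδ (hf a b))) (hw a b)
          simp only [hp, hq]
          linarith
      _ = 4 * δ ^ 2 * ∑ a, ∑ b, w1 a * w2 b * f a b ^ 2 := by
          simp only [← mul_sum]
          ring
  calc ∑ a, ∑ b, w1 a * w2 b * (f a b * J a b + p a b * q a b) ^ 2
      ≤ ∑ a, ∑ b, (δ ^ 2 * (w1 a * w2 b * f a b ^ 2)
          + 2 * δ * (w1 a * w2 b * (f a b * p a b * q a b))
          + w1 a * w2 b * (p a b * q a b) ^ 2) := by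
        refine sum_le_sum fun a _ => sum_le_sum fun b _ => ?_
        have hpq := mul_nonneg (p0 a b) (q0 a b)
        have hfJ := mul_nonneg (hf a b) (J0 a b)
        have i1 : (f a b * J a b) ^ 2 ≤ (δ * f a b) ^ 2 := pow_le_pow_left₀ hfJ (hJ a b) 2
        have i2 := mul_le_mul_of_nonneg_right (hJ a b) hpq
        have := mul_le_mul_of_nonneg_left (add_le_add i1 (mul_le_mul_of_nonneg_left i2 zero_le_two))
          (hw a b)
        simp only [hJdef, hq] at this ⊢
        linarith
    _ ≤ _ := by
        simp only [sum_add_distrib, ← mul_sum]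
        have := mul_le_mul_of_nonneg_left mixed (mul_nonneg zero_le_two hδ)
        linarith

end BiTree

theorem stmt17 {T1 T2 : Type*} [Fintype T1] [PartialOrder T1] [Fintype T2] [PartialOrder T2]
    (h1 : IsTreeOrder T1) (h2 : IsTreeOrder T2)
    (w1 : T1 → ℝ) (w2 : T2 → ℝ) (hw1 : ∀ x, 0 ≤ w1 x) (hw2 : ∀ x, 0 ≤ w2 x)
    (μ ρ : T1 × T2 → ℝ) (hμ : ∀ a, 0 ≤ μ a) (hρ : ∀ a, 0 ≤ ρ a)
    (δ : ℝ) (hδ : 0 < δ) :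
    (∑ a, hI (fun x =>
        (if hI (fun y => w1 y.1 * w2 y.2 * hIstar μ y) x ≤ δ then 1 else 0) *
          (w1 x.1 * w2 x.2 * hIstar μ x)) a * ρ a) ^ 4
      ≤ 28 * δ ^ 2 *
        (∑ a, (if hI (fun y => w1 y.1 * w2 y.2 * hIstar μ y) a ≤ δ then 1 else 0) *
          (w1 a.1 * w2 a.2 * hIstar μ a ^ 2)) *
        (∑ a, w1 a.1 * w2 a.2 * hIstar ρ a ^ 2) * (∑ a, ρ a) ^ 2 := by
  have hw : ∀ a b, 0 ≤ w1 a * w2 b := fun a b => mul_nonneg (hw1 a) (hw2 b)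
  have hm0 : ∀ a, 0 ≤ hIstar μ a := hIstar_nonneg hμ
  have hwm0 : ∀ y : T1 × T2, 0 ≤ w1 y.1 * w2 y.2 * hIstar μ y := fun y =>
    mul_nonneg (hw y.1 y.2) (hm0 y)
  set V : T1 × T2 → ℝ := hI (fun y => w1 y.1 * w2 y.2 * hIstar μ y) with hV
  have hVanti : Antitone V := hI_antitone hwm0
  set f : T1 → T2 → ℝ := fun a b => (if V (a, b) ≤ δ then 1 else 0) * hIstar μ (a, b) with hfdef
  have hf : ∀ a b, 0 ≤ f a b := fun a b => by
    simp only [hfdef]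
    split_ifs <;> simp [hm0]
  have hpot : ∀ a b, V (a, b) ≤ δ → hI (fun x => w1 x * hI (fun y => w2 y * f x y) b) a ≤ δ := by
    intro a b hab
    refine le_trans ?_ hab
    rw [hV, hI_prod]
    refine hI_mono (fun x => ?_) a
    rw [← hI_const_mul]
    refine hI_mono (fun y => ?_) b
    have := hwm0 (x, y)
    simp only [hfdef]
    split_ifs
    · simp [mul_assoc]
    · simpa using this
  have hpot' : ∀ a b, V (a, b) ≤ δ → hI (fun y => w2 y * hI (fun x => w1 x * f x y) a) b ≤ δ := by
    intro a b hab
    refine le_trans (le_of_eq ?_) (hpot a b hab)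
    simp only [← hI_const_mul]
    rw [hI_comm (fun x y => w1 x * (w2 y * f x y))]
    simp only [mul_left_comm]
  have hJ : ∀ a b, f a b * hI (fun x => w1 x * hI (fun y => w2 y * f x y) b) a ≤ δ * f a b := by
    intro a b
    by_cases h : V (a, b) ≤ δ
    · rw [mul_comm]
      exact mul_le_mul_of_nonneg_right (hpot a b h) (hf a b)
    · simp [hfdef, h]
  have hJ1 : ∀ a b, hIstar (fun x => w1 x * hI (fun y => w2 y * f x y) b * f x b) a
      ≤ δ * f a b := by
    intro a b
    have := hIstar_truncated_mul_le h1 (P := fun a => V (a, b) ≤ δ)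
      (g := fun x => w1 x * hI (fun y => w2 y * f x y) b)
      (ν := fun x => hIstar (fun y => μ (x, y)) b)
      (fun x => mul_nonneg (hw1 x) (hI_nonneg (fun y => mul_nonneg (hw2 y) (hf x y)) b))
      (fun x => hIstar_nonneg (fun y => hμ (x, y)) b)
      (fun c d hcd hc => (hVanti (Prod.mk_le_mk.2 ⟨hcd, le_rfl⟩)).trans hc) hδ.le
      (fun m hm => hpot m b hm) a
    simpa only [← hIstar_prod] using this
  have hJ2 : ∀ a b, hIstar (fun y => w2 y * hI (fun x => w1 x * f x y) a * f a y) b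
      ≤ δ * f a b := by
    intro a b
    have := hIstar_truncated_mul_le h2 (P := fun b => V (a, b) ≤ δ)
      (g := fun y => w2 y * hI (fun x => w1 x * f x y) a)
      (ν := fun y => hIstar (fun x => μ (x, y)) a)
      (fun y => mul_nonneg (hw2 y) (hI_nonneg (fun x => mul_nonneg (hw1 x) (hf x y)) a))
      (fun y => hIstar_nonneg (fun x => hμ (x, y)) a)
      (fun c d hcd hc => (hVanti (Prod.mk_le_mk.2 ⟨le_rfl, hcd⟩)).trans hc) hδ.le
      (fun m hm => hpot' a m hm) b
    simpa only [← hIstar_prod'] using this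
  have hE := energy_le h1 h2 hw1 hw2 hf hδ.le hJ hJ1 hJ2
  set φ : T1 × T2 → ℝ := fun z =>
    f z.1 z.2 * hI (fun x => w1 x * hI (fun y => w2 y * f x y) z.2) z.1
      + hI (fun x => w1 x * f x z.2) z.1 * hI (fun y => w2 y * f z.1 y) z.2 with hφ
  have hVδ : (fun x : T1 × T2 => (if V x ≤ δ then 1 else 0) * (w1 x.1 * w2 x.2 * hIstar μ x))
      = fun z => w1 z.1 * w2 z.2 * f z.1 z.2 := by
    funext z
    simp only [hfdef]
    ring
  have hEδ : ∑ a, (if V a ≤ δ then 1 else 0) * (w1 a.1 * w2 a.2 * hIstar μ a ^ 2)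
      = ∑ a, ∑ b, w1 a * w2 b * f a b ^ 2 := by
    rw [Fintype.sum_prod_type]
    refine sum_congr rfl fun a _ => sum_congr rfl fun b _ => ?_
    simp only [hfdef]
    split_ifs <;> simp
  rw [hVδ, hEδ]
  set W := hI (fun z : T1 × T2 => w1 z.1 * w2 z.2 * f z.1 z.2) with hW
  set N := ∑ a, ∑ b, w1 a * w2 b * f a b ^ 2
  have hWsq : ∀ a, W a ^ 2 ≤ 2 * hI (fun z => w1 z.1 * w2 z.2 * φ z) a := fun a =>
    hI_prod_sq_le h1 h2 hw1 hw2 hf a.1 a.2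
  have hφE : ∑ a, w1 a.1 * w2 a.2 * φ a ^ 2 ≤ 7 * δ ^ 2 * N := by
    rw [Fintype.sum_prod_type]
    exact hE
  have c1 : (∑ a, W a * ρ a) ^ 2 ≤ (∑ a, W a ^ 2 * ρ a) * ∑ a, ρ a :=
    sum_sq_le_sum_mul_sum_of_sq_le_mul _ (fun a _ => mul_nonneg (sq_nonneg _) (hρ a))
      (fun a _ => hρ a) (fun a _ => le_of_eq (by ring))
  have c2 : ∑ a, W a ^ 2 * ρ a ≤ 2 * ∑ a, w1 a.1 * w2 a.2 * φ a * hIstar ρ a := by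
    rw [← sum_hI_mul, mul_sum]
    refine sum_le_sum fun a _ => ?_
    rw [← mul_assoc]
    exact mul_le_mul_of_nonneg_right (hWsq a) (hρ a)
  have c3 : (∑ a, w1 a.1 * w2 a.2 * φ a * hIstar ρ a) ^ 2
      ≤ (∑ a, w1 a.1 * w2 a.2 * φ a ^ 2) * ∑ a, w1 a.1 * w2 a.2 * hIstar ρ a ^ 2 :=
    sum_sq_le_sum_mul_sum_of_sq_le_mul _
      (fun a _ => mul_nonneg (hw a.1 a.2) (sq_nonneg _))
      (fun a _ => mul_nonneg (hw a.1 a.2) (sq_nonneg _)) (fun a _ => le_of_eq (by ring))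
  have hS0 : 0 ≤ ∑ a, W a ^ 2 * ρ a := sum_nonneg fun a _ => mul_nonneg (sq_nonneg _) (hρ a)
  have hEρ : 0 ≤ ∑ a, w1 a.1 * w2 a.2 * hIstar ρ a ^ 2 :=
    sum_nonneg fun a _ => mul_nonneg (hw a.1 a.2) (sq_nonneg _)
  have c4 : (∑ a, W a ^ 2 * ρ a) ^ 2
      ≤ 28 * δ ^ 2 * N * ∑ a, w1 a.1 * w2 a.2 * hIstar ρ a ^ 2 := by
    have i1 := pow_le_pow_left₀ hS0 c2 2
    have i2 := mul_le_mul_of_nonneg_right hφE hEρ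
    rw [mul_pow] at i1
    linarith
  calc (∑ a, W a * ρ a) ^ 4 = ((∑ a, W a * ρ a) ^ 2) ^ 2 := by ring
    _ ≤ ((∑ a, W a ^ 2 * ρ a) * ∑ a, ρ a) ^ 2 := pow_le_pow_left₀ (sq_nonneg _) c1 2
    _ = (∑ a, W a ^ 2 * ρ a) ^ 2 * (∑ a, ρ a) ^ 2 := by ring
    _ ≤ _ := mul_le_mul_of_nonneg_right c4 (sq_nonneg _)
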